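/- Let n ≥ 2 and let G ⊆ U(n) be a finite subgroup. For λ > 0 set dim H(λ) = Σ over pairs (p,q) with 0 < q(p+n−1) ≤ λ of dim_ℂ H_{p,q}, and dim H^G(λ) = Σ over the same pairs of dim_ℂ H_{p,q}^G. Then |dim H^G(λ) − (1/|G|)·dim H(λ)| ≤ (|G|−1)·Ξ_λ. -/

import Mathlib

noncomputable section

open MvPolynomial Matrix Complex Real Filter

/-- Variables: `Sum.inl i` is `z i`, `Sum.inr i` is `conj (z i)`. -/
abbrev Var (n : ℕ) := Fin n ⊕ Fin n

/-- Bidegree weight: `z`-variables have weight (1,0), `z̄`-variables weight (0,1). -/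
def bidegWt (n : ℕ) : Var n → ℕ × ℕ :=
  Sum.elim (fun _ => ((1 : ℕ), (0 : ℕ))) (fun _ => ((0 : ℕ), (1 : ℕ)))

/-- The Laplacian `∑ i, ∂²/∂zᵢ∂z̄ᵢ` on polynomials in `z, z̄`. -/
def kohnLap (n : ℕ) : MvPolynomial (Var n) ℂ →ₗ[ℂ] MvPolynomial (Var n) ℂ :=
  ∑ i : Fin n, ((pderiv (R := ℂ) (Sum.inl i)).toLinearMap.comp
    (pderiv (R := ℂ) (Sum.inr i)).toLinearMap)

/-- `H_{p,q}`: harmonic polynomials on ℂⁿ of bidegree `(p,q)`. -/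
def Hpq (n p q : ℕ) : Submodule ℂ (MvPolynomial (Var n) ℂ) :=
  (weightedHomogeneousSubmodule ℂ (bidegWt n) (p, q)) ⊓ (LinearMap.ker (kohnLap n))

/-- The action of a unitary matrix `g` on polynomials, `(g · f)(z) = f(g⁻¹ z)`:
substitution `zᵢ ↦ ∑ⱼ (g⁻¹)ᵢⱼ zⱼ`, `z̄ᵢ ↦ ∑ⱼ conj((g⁻¹)ᵢⱼ) z̄ⱼ`. -/
def uAct (n : ℕ) (g : Matrix.unitaryGroup (Fin n) ℂ) :
    MvPolynomial (Var n) ℂ →ₐ[ℂ] MvPolynomial (Var n) ℂ :=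
  aeval (Sum.elim
    (fun i => ∑ j : Fin n,
      MvPolynomial.C ((g⁻¹ : Matrix.unitaryGroup (Fin n) ℂ) i j) * X (Sum.inl j))
    (fun i => ∑ j : Fin n,
      MvPolynomial.C ((starRingEnd ℂ) ((g⁻¹ : Matrix.unitaryGroup (Fin n) ℂ) i j)) * X (Sum.inr j)))

/-- `H_{p,q}^S`: the subspace of `H_{p,q}` invariant under every element of `S`. -/
def HpqInv (n p q : ℕ) (S : Set (Matrix.unitaryGroup (Fin n) ℂ)) :
    Submodule ℂ (MvPolynomial (Var n) ℂ) :=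
  Hpq n p q ⊓ (⨅ g ∈ S, LinearMap.ker ((uAct n g).toLinearMap - LinearMap.id))

/-- `dim_ℂ H_{p,q}^S`. -/
def dimHpqInv (n p q : ℕ) (S : Set (Matrix.unitaryGroup (Fin n) ℂ)) : ℕ :=
  Module.finrank ℂ (HpqInv n p q S)

/-- A set of unitary matrices acts freely on the sphere iff no element other than
the identity has `1` as an eigenvalue. -/
def actsFreely {n : ℕ} (S : Set (Matrix.unitaryGroup (Fin n) ℂ)) : Prop :=
  ∀ g ∈ S, ((g : Matrix (Fin n) (Fin n) ℂ) - 1).det = 0 → g = 1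

/-- `dim H(λ) = ∑_{0 < q(p+n-1) ≤ λ} dim H_{p,q}`. -/
def dimHlam (n : ℕ) (lam : ℝ) : ℕ :=
  ∑ pq ∈ (Finset.range (⌊lam⌋₊ + 1) ×ˢ Finset.range (⌊lam⌋₊ + 1)).filter
      (fun pq => 0 < pq.2 * (pq.1 + n - 1) ∧ ((pq.2 * (pq.1 + n - 1) : ℕ) : ℝ) ≤ lam),
    Module.finrank ℂ (Hpq n pq.1 pq.2)

/-- `dim H^G(λ) = ∑_{0 < q(p+n-1) ≤ λ} dim H_{p,q}^G`. -/
def dimHGlam (n : ℕ) (S : Set (Matrix.unitaryGroup (Fin n) ℂ)) (lam : ℝ) : ℕ :=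
  ∑ pq ∈ (Finset.range (⌊lam⌋₊ + 1) ×ˢ Finset.range (⌊lam⌋₊ + 1)).filter
      (fun pq => 0 < pq.2 * (pq.1 + n - 1) ∧ ((pq.2 * (pq.1 + n - 1) : ℕ) : ℝ) ≤ lam),
    dimHpqInv n pq.1 pq.2 S

/-- `Ξ_λ` from the paper. -/
def Xi (n : ℕ) (lam : ℝ) : ℕ :=
  (∑ k ∈ Finset.range (⌊lam⌋₊ + 2 - n),
    Nat.choose (k + n - 2) (n - 2) *
      Nat.choose (⌊lam / ((k : ℝ) + n - 1)⌋₊ + n - 2) (n - 1)) +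
  ∑ k ∈ Finset.Icc 1 ⌊lam / ((n : ℝ) - 1)⌋₊,
    Nat.choose (k + n - 2) (n - 2) * Nat.choose ⌊lam / (k : ℝ)⌋₊ (n - 1)

section Substitution

/-- The substitution `zᵢ ↦ ∑ⱼ Aᵢⱼ zⱼ`, `z̄ᵢ ↦ ∑ⱼ Bᵢⱼ z̄ⱼ`. -/
def linSubst {n : ℕ} (A B : Matrix (Fin n) (Fin n) ℂ) :
    MvPolynomial (Var n) ℂ →ₐ[ℂ] MvPolynomial (Var n) ℂ :=
  aeval (Sum.elim
    (fun i => ∑ j : Fin n, MvPolynomial.C (A i j) * X (Sum.inl j))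
    (fun i => ∑ j : Fin n, MvPolynomial.C (B i j) * X (Sum.inr j)))

variable {n : ℕ}

@[simp]
lemma linSubst_X_inl (A B : Matrix (Fin n) (Fin n) ℂ) (i : Fin n) :
    linSubst A B (X (Sum.inl i)) = ∑ j : Fin n, MvPolynomial.C (A i j) * X (Sum.inl j) := by
  simp [linSubst]

@[simp]
lemma linSubst_X_inr (A B : Matrix (Fin n) (Fin n) ℂ) (i : Fin n) :
    linSubst A B (X (Sum.inr i)) = ∑ j : Fin n, MvPolynomial.C (B i j) * X (Sum.inr j) := by
  simp [linSubst]

lemma linSubst_comp (A B A' B' : Matrix (Fin n) (Fin n) ℂ) :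
    (linSubst A B).comp (linSubst A' B') = linSubst (A' * A) (B' * B) := by
  refine MvPolynomial.algHom_ext fun v => ?_
  rcases v with i | i
  all_goals
    simp only [AlgHom.comp_apply, linSubst_X_inl, linSubst_X_inr, map_sum, map_mul,
      MvPolynomial.algHom_C, Finset.mul_sum, Matrix.mul_apply, Finset.sum_mul]
    rw [Finset.sum_comm]
    simp [MvPolynomial.algebraMap_eq, mul_assoc]

lemma linSubst_one : linSubst (1 : Matrix (Fin n) (Fin n) ℂ) 1 = AlgHom.id ℂ _ := by
  refine MvPolynomial.algHom_ext fun v => ?_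
  rcases v with i | i <;> simp [Matrix.one_apply, apply_ite MvPolynomial.C]

lemma uAct_eq_linSubst (g : Matrix.unitaryGroup (Fin n) ℂ) :
    uAct n g = linSubst ((g⁻¹ : Matrix.unitaryGroup (Fin n) ℂ) : Matrix (Fin n) (Fin n) ℂ)
      (((g⁻¹ : Matrix.unitaryGroup (Fin n) ℂ) : Matrix (Fin n) (Fin n) ℂ).map (starRingEnd ℂ)) :=
  rfl

lemma uAct_mul (g h : Matrix.unitaryGroup (Fin n) ℂ) :
    uAct n (g * h) = (uAct n g).comp (uAct n h) := by
  simp only [uAct_eq_linSubst, linSubst_comp, _root_.mul_inv_rev]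
  congr 1
  simp only [Submonoid.coe_mul, Matrix.map_mul]

lemma uAct_one : uAct n 1 = AlgHom.id ℂ _ := by
  rw [uAct_eq_linSubst, ← linSubst_one]
  congr 1
  · simp
  · simp [Matrix.map_one]

lemma unitary_mul_transpose_map (g : Matrix.unitaryGroup (Fin n) ℂ) :
    (g : Matrix (Fin n) (Fin n) ℂ) *
      ((g : Matrix (Fin n) (Fin n) ℂ).map (starRingEnd ℂ))ᵀ = 1 := by
  have h := Unitary.mul_star_self_of_mem g.2
  exact h

lemma pderiv_inl_linSubst (A B : Matrix (Fin n) (Fin n) ℂ) (i : Fin n)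
    (f : MvPolynomial (Var n) ℂ) :
    pderiv (Sum.inl i) (linSubst A B f) =
      ∑ k, MvPolynomial.C (A k i) * linSubst A B (pderiv (Sum.inl k) f) := by
  induction f using MvPolynomial.induction_on with
  | C a => simp
  | add p q hp hq => simp [hp, hq, mul_add, Finset.sum_add_distrib]
  | mul_X p v hp =>
    simp only [map_mul, Derivation.leibniz, hp, smul_eq_mul, map_add, mul_add,
      Finset.sum_add_distrib]
    congr 1
    · rcases v with j | j
      · simp [pderiv_X, Pi.single_apply, mul_comm, apply_ite]
      · simp [pderiv_X]
    · rw [Finset.mul_sum]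
      exact Finset.sum_congr rfl fun k _ => by ring

lemma pderiv_inr_linSubst (A B : Matrix (Fin n) (Fin n) ℂ) (i : Fin n)
    (f : MvPolynomial (Var n) ℂ) :
    pderiv (Sum.inr i) (linSubst A B f) =
      ∑ k, MvPolynomial.C (B k i) * linSubst A B (pderiv (Sum.inr k) f) := by
  induction f using MvPolynomial.induction_on with
  | C a => simp
  | add p q hp hq => simp [hp, hq, mul_add, Finset.sum_add_distrib]
  | mul_X p v hp =>
    simp only [map_mul, Derivation.leibniz, hp, smul_eq_mul, map_add, mul_add,
      Finset.sum_add_distrib]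
    congr 1
    · rcases v with j | j
      · simp [pderiv_X]
      · simp [pderiv_X, Pi.single_apply, mul_comm, apply_ite]
    · rw [Finset.mul_sum]
      exact Finset.sum_congr rfl fun k _ => by ring

lemma kohnLap_apply (f : MvPolynomial (Var n) ℂ) :
    kohnLap n f = ∑ i, pderiv (Sum.inl i) (pderiv (Sum.inr i) f) := by
  simp [kohnLap, LinearMap.sum_apply]

lemma kohnLap_linSubst {A B : Matrix (Fin n) (Fin n) ℂ} (hAB : A * Bᵀ = 1)
    (f : MvPolynomial (Var n) ℂ) :
    kohnLap n (linSubst A B f) = linSubst A B (kohnLap n f) := by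
  simp only [kohnLap_apply, pderiv_inr_linSubst, map_sum, Derivation.leibniz, pderiv_C,
    mul_zero, add_zero, pderiv_inl_linSubst, smul_eq_mul, Finset.mul_sum]
  have key (k l : Fin n) : ∑ i, A k i * B l i = if k = l then 1 else 0 := by
    simpa [Matrix.mul_apply, Matrix.one_apply] using congrFun (congrFun hAB k) l
  rw [Finset.sum_comm]
  refine Finset.sum_congr rfl fun l _ => ?_
  rw [Finset.sum_comm]
  have (k : Fin n) : ∑ i, MvPolynomial.C (B l i) * (MvPolynomial.C (A k i) *
      linSubst A B (pderiv (Sum.inl k) (pderiv (Sum.inr l) f))) =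
      MvPolynomial.C (if k = l then 1 else 0) *
        linSubst A B (pderiv (Sum.inl k) (pderiv (Sum.inr l) f)) := by
    rw [← key k l, map_sum, Finset.sum_mul]
    exact Finset.sum_congr rfl fun i _ => by rw [map_mul]; ring
  simp [this, apply_ite]

lemma linSubst_isWeightedHomogeneous (A B : Matrix (Fin n) (Fin n) ℂ)
    {f : MvPolynomial (Var n) ℂ} {m : ℕ × ℕ} (hf : IsWeightedHomogeneous (bidegWt n) f m) :
    IsWeightedHomogeneous (bidegWt n) (linSubst A B f) m := by
  have hX (v : Var n) : IsWeightedHomogeneous (bidegWt n) (linSubst A B (X v)) (bidegWt n v) := by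
    rcases v with i | i
    · rw [linSubst_X_inl]
      exact IsWeightedHomogeneous.sum _ _ _ fun j _ =>
        IsWeightedHomogeneous.C_mul (isWeightedHomogeneous_X ℂ (bidegWt n) (Sum.inl j)) _
    · rw [linSubst_X_inr]
      exact IsWeightedHomogeneous.sum _ _ _ fun j _ =>
        IsWeightedHomogeneous.C_mul (isWeightedHomogeneous_X ℂ (bidegWt n) (Sum.inr j)) _
  rw [f.as_sum, map_sum]
  refine IsWeightedHomogeneous.sum _ _ _ fun d hd => ?_
  rw [monomial_eq, map_mul, MvPolynomial.algHom_C, MvPolynomial.algebraMap_eq]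
  refine IsWeightedHomogeneous.C_mul ?_ _
  rw [Finsupp.prod, map_prod, ← hf (mem_support_iff.mp hd), Finsupp.weight_apply, Finsupp.sum]
  refine IsWeightedHomogeneous.prod _ _ _ fun v _ => ?_
  rw [map_pow]
  exact (hX v).pow _

lemma linSubst_mem_Hpq {A B : Matrix (Fin n) (Fin n) ℂ} (hAB : A * Bᵀ = 1) {p q : ℕ}
    {f : MvPolynomial (Var n) ℂ} (hf : f ∈ Hpq n p q) : linSubst A B f ∈ Hpq n p q := by
  refine ⟨linSubst_isWeightedHomogeneous A B hf.1, ?_⟩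
  change kohnLap n _ = 0
  rw [kohnLap_linSubst hAB, LinearMap.mem_ker.mp hf.2, map_zero]

/-- The restriction to `H_{p,q}` of a linear substitution preserving the Laplacian. -/
def linSubstHpq {A B : Matrix (Fin n) (Fin n) ℂ} (hAB : A * Bᵀ = 1) (p q : ℕ) :
    Hpq n p q →ₗ[ℂ] Hpq n p q :=
  (linSubst A B).toLinearMap.restrict fun _ hf => linSubst_mem_Hpq hAB hf

lemma coeff_linSubst_diagonal (x y : Fin n → ℂ) (f : MvPolynomial (Var n) ℂ) (d : Var n →₀ ℕ) :
    coeff d (linSubst (diagonal x) (diagonal y) f) =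
      (∏ i, x i ^ d (Sum.inl i)) * (∏ i, y i ^ d (Sum.inr i)) * coeff d f := by
  induction f using MvPolynomial.induction_on' with
  | add p q hp hq => simp [hp, hq, mul_add]
  | monomial u a =>
    have : linSubst (diagonal x) (diagonal y) (monomial u a) =
        MvPolynomial.C ((∏ i, x i ^ u (Sum.inl i)) * (∏ i, y i ^ u (Sum.inr i))) *
          monomial u a := by
      rw [monomial_eq, map_mul, MvPolynomial.algHom_C, MvPolynomial.algebraMap_eq,
        Finsupp.prod_fintype _ _ (by simp)]
      simp only [map_prod, Fintype.prod_sum_type, map_pow, linSubst_X_inl, linSubst_X_inr,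
        diagonal_apply, apply_ite MvPolynomial.C, map_zero, ite_mul, zero_mul,
        Finset.sum_ite_eq, Finset.mem_univ, if_true, mul_pow, Finset.prod_mul_distrib, map_mul]
      ring
    rw [this, coeff_C_mul, coeff_monomial]
    split_ifs with h
    · rw [h]
    · simp

end Substitution

section Basis

variable {n : ℕ}

/-- The exponent vector of the monomial `z^a z̄^b`. -/
def bidegExp (a b : Fin n → ℕ) : Var n →₀ ℕ :=
  Finsupp.equivFunOnFinite.symm (Sum.elim a b)

@[simp]
lemma bidegExp_inl (a b : Fin n → ℕ) (i : Fin n) : bidegExp a b (Sum.inl i) = a i := rfl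

@[simp]
lemma bidegExp_inr (a b : Fin n → ℕ) (i : Fin n) : bidegExp a b (Sum.inr i) = b i := rfl

lemma bidegExp_eta (d : Var n →₀ ℕ) :
    bidegExp (fun i => d (Sum.inl i)) (fun i => d (Sum.inr i)) = d := by
  ext v
  rcases v with i | i <;> simp

lemma bidegExp_injective {a b a' b' : Fin n → ℕ} (h : bidegExp a b = bidegExp a' b') :
    a = a' ∧ b = b' :=
  ⟨funext fun i => by simpa using DFunLike.congr_fun h (Sum.inl i),
    funext fun i => by simpa using DFunLike.congr_fun h (Sum.inr i)⟩

lemma weight_bidegWt (d : Var n →₀ ℕ) :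
    Finsupp.weight (bidegWt n) d = (∑ i, d (Sum.inl i), ∑ i, d (Sum.inr i)) := by
  rw [Finsupp.weight_apply, Finsupp.sum_fintype _ _ (by simp)]
  ext <;> simp [bidegWt, Prod.fst_sum, Prod.snd_sum]

/-- Pairs of exponents `(a, b)` of the monomials `z^a z̄^b` of bidegree `(p, q)`. -/
def bidegPairs (n p q : ℕ) : Finset ((Fin n → ℕ) × (Fin n → ℕ)) :=
  Finset.piAntidiag Finset.univ p ×ˢ Finset.piAntidiag Finset.univ q

lemma mem_bidegPairs {p q : ℕ} {ab : (Fin n → ℕ) × (Fin n → ℕ)} :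
    ab ∈ bidegPairs n p q ↔ Finsupp.weight (bidegWt n) (bidegExp ab.1 ab.2) = (p, q) := by
  simp [bidegPairs, weight_bidegWt, Finset.mem_piAntidiag]

/-- A bihomogeneous polynomial is the same as its family of coefficients. -/
def coeffEquiv (n p q : ℕ) :
    weightedHomogeneousSubmodule ℂ (bidegWt n) (p, q) ≃ₗ[ℂ] (bidegPairs n p q → ℂ) where
  toFun f ab := coeff (bidegExp ab.1.1 ab.1.2) (f : MvPolynomial (Var n) ℂ)
  map_add' f g := by ext; simp
  map_smul' c f := by ext; simp
  invFun c := ⟨∑ ab : bidegPairs n p q, monomial (bidegExp ab.1.1 ab.1.2) (c ab),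
    Submodule.sum_mem _ fun ab _ => isWeightedHomogeneous_monomial _ _ _ (mem_bidegPairs.mp ab.2)⟩
  left_inv f := by
    ext d
    by_cases hd : Finsupp.weight (bidegWt n) d = (p, q)
    · have hmem : ((fun i => d (Sum.inl i)), (fun i => d (Sum.inr i))) ∈ bidegPairs n p q := by
        rw [mem_bidegPairs, bidegExp_eta, hd]
      simp only [coeff_sum, coeff_monomial]
      rw [Finset.sum_eq_single ⟨_, hmem⟩]
      · simp [bidegExp_eta]
      · intro ab _ hab
        rw [if_neg]
        rintro rfl
        exact hab rfl
      · simp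
    · rw [f.2.coeff_eq_zero d hd, coeff_sum]
      refine Finset.sum_eq_zero fun ab _ => ?_
      rw [coeff_monomial, if_neg]
      rintro rfl
      exact hd (mem_bidegPairs.mp ab.2)
  right_inv c := by
    ext ab
    simp only [coeff_sum, coeff_monomial]
    rw [Finset.sum_eq_single ab]
    · simp
    · intro ab' _ hab
      rw [if_neg]
      intro h
      obtain ⟨h1, h2⟩ := bidegExp_injective h
      exact hab (Subtype.ext (Prod.ext h1 h2))
    · simp

instance (p q : ℕ) : Module.Finite ℂ (weightedHomogeneousSubmodule ℂ (bidegWt n) (p, q)) :=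
  Module.Finite.equiv (coeffEquiv n p q).symm

instance (p q : ℕ) : Module.Finite ℂ (Hpq n p q) :=
  Module.Finite.of_injective (Submodule.inclusion inf_le_left)
    (Submodule.inclusion_injective (inf_le_left : Hpq n p q ≤ _))

/-- The exponent vector of `zᵢ z̄ᵢ`. -/
def normExp (i : Fin n) : Var n →₀ ℕ :=
  Finsupp.single (Sum.inl i) 1 + Finsupp.single (Sum.inr i) 1

@[simp]
lemma normExp_inl (i j : Fin n) : normExp i (Sum.inl j) = if i = j then 1 else 0 := by
  simp [normExp, Finsupp.single_apply]

@[simp]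
lemma normExp_inr (i j : Fin n) : normExp i (Sum.inr j) = if i = j then 1 else 0 := by
  simp [normExp, Finsupp.single_apply]

lemma weight_normExp (i : Fin n) : Finsupp.weight (bidegWt n) (normExp i) = (1, 1) := by
  simp [weight_bidegWt]

lemma coeff_kohnLap (f : MvPolynomial (Var n) ℂ) (d : Var n →₀ ℕ) :
    coeff d (kohnLap n f) =
      ∑ i, ((d (Sum.inl i) + 1 : ℕ) : ℂ) * ((d (Sum.inr i) + 1 : ℕ) : ℂ) *
        coeff (d + normExp i) f := by
  rw [kohnLap_apply, coeff_sum]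
  refine Finset.sum_congr rfl fun i _ => ?_
  simp only [coeff_pderiv, Finsupp.add_apply, Finsupp.single_apply, normExp, add_assoc]
  simp
  ring

/-- Polynomials are determined by their Laplacian and their coefficients at the monomials not
divisible by `zᵢ z̄ᵢ`. -/
lemma eq_zero_of_kohnLap_of_coeff (i₀ : Fin n) (f : MvPolynomial (Var n) ℂ)
    (hΔ : kohnLap n f = 0)
    (hf : ∀ d, d (Sum.inl i₀) = 0 ∨ d (Sum.inr i₀) = 0 → coeff d f = 0) : f = 0 := by
  suffices ∀ (k : ℕ) (d : Var n →₀ ℕ), d (Sum.inl i₀) = k → coeff d f = 0 by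
    ext d
    simpa using this _ d rfl
  intro k
  induction k with
  | zero => exact fun d hd => hf d (Or.inl hd)
  | succ k ih =>
    intro d hd
    by_cases hd' : d (Sum.inr i₀) = 0
    · exact hf d (Or.inr hd')
    have hle : normExp i₀ ≤ d := by
      rintro (j | j)
      · rw [normExp_inl]
        split_ifs with h
        · subst h; omega
        · simp
      · rw [normExp_inr]
        split_ifs with h
        · subst h; omega
        · simp
    obtain ⟨e, rfl⟩ := exists_add_of_le hle
    rw [add_comm] at hd ⊢
    have he : e (Sum.inl i₀) = k := by simpa using hd
    have h := coeff_kohnLap f e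
    rw [hΔ, coeff_zero, Finset.sum_eq_single i₀] at h
    · have h1 : ((e (Sum.inl i₀) + 1 : ℕ) : ℂ) ≠ 0 := Nat.cast_ne_zero.mpr (by omega)
      have h2 : ((e (Sum.inr i₀) + 1 : ℕ) : ℂ) ≠ 0 := Nat.cast_ne_zero.mpr (by omega)
      simpa [h1, h2, -Nat.cast_add] using h.symm
    · intro j _ hj
      rw [ih _ (by simp [he, hj]), mul_zero]
    · simp

/-- Exponents of the monomials of bidegree `(p, q)` not divisible by `zᵢ z̄ᵢ`. -/
def reducedPairs (p q : ℕ) (i₀ : Fin n) : Finset ((Fin n → ℕ) × (Fin n → ℕ)) :=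
  (bidegPairs n p q).filter fun ab => ab.1 i₀ = 0 ∨ ab.2 i₀ = 0

lemma mem_reducedPairs {p q : ℕ} {i₀ : Fin n} {ab : (Fin n → ℕ) × (Fin n → ℕ)} :
    ab ∈ reducedPairs p q i₀ ↔ ab ∈ bidegPairs n p q ∧ (ab.1 i₀ = 0 ∨ ab.2 i₀ = 0) :=
  Finset.mem_filter

/-- The coefficients of a harmonic polynomial at the monomials not divisible by `zᵢ z̄ᵢ`. -/
def reducedCoeff (p q : ℕ) (i₀ : Fin n) : Hpq n p q →ₗ[ℂ] (reducedPairs p q i₀ → ℂ) where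
  toFun f ab := coeff (bidegExp ab.1.1 ab.1.2) (f : MvPolynomial (Var n) ℂ)
  map_add' f g := by ext; simp
  map_smul' c f := by ext; simp

lemma reducedCoeff_injective (p q : ℕ) (i₀ : Fin n) :
    Function.Injective (reducedCoeff p q i₀) := by
  rw [injective_iff_map_eq_zero]
  rintro ⟨f, hf⟩ h0
  rw [Subtype.ext_iff]
  refine eq_zero_of_kohnLap_of_coeff i₀ f hf.2 fun d hd => ?_
  by_cases hw : Finsupp.weight (bidegWt n) d = (p, q)
  · have hmem : ((fun i => d (Sum.inl i)), (fun i => d (Sum.inr i))) ∈ reducedPairs p q i₀ := by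
      rw [reducedPairs, Finset.mem_filter, mem_bidegPairs, bidegExp_eta, hw]
      exact ⟨rfl, hd⟩
    simpa [reducedCoeff, bidegExp_eta] using congrFun h0 ⟨_, hmem⟩
  · exact hf.1.coeff_eq_zero d hw

lemma reducedCoeff_surjective (p q : ℕ) (i₀ : Fin n) :
    Function.Surjective (reducedCoeff p q i₀) := by
  let E : weightedHomogeneousSubmodule ℂ (bidegWt n) (p, q) →ₗ[ℂ] (bidegPairs n p q → ℂ) :=
    LinearMap.pi fun ab => if ab.1.1 i₀ = 0 ∨ ab.1.2 i₀ = 0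
      then (lcoeff ℂ (bidegExp ab.1.1 ab.1.2)).comp (Submodule.subtype _)
      else (lcoeff ℂ (bidegExp ab.1.1 ab.1.2 - normExp i₀)).comp
        ((kohnLap n).comp (Submodule.subtype _))
  have hE1 (f) (ab : bidegPairs n p q) (h : ab.1.1 i₀ = 0 ∨ ab.1.2 i₀ = 0) :
      E f ab = coeff (bidegExp ab.1.1 ab.1.2) (f : MvPolynomial (Var n) ℂ) := by
    simp only [E, LinearMap.pi_apply, if_pos h]
    rfl
  have hE2 (f) (ab : bidegPairs n p q) (h : ¬ (ab.1.1 i₀ = 0 ∨ ab.1.2 i₀ = 0)) :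
      E f ab = coeff (bidegExp ab.1.1 ab.1.2 - normExp i₀) (kohnLap n f) := by
    simp only [E, LinearMap.pi_apply, if_neg h]
    rfl
  have hΔ (f : weightedHomogeneousSubmodule ℂ (bidegWt n) (p, q))
      (hf : ∀ ab : bidegPairs n p q, ¬ (ab.1.1 i₀ = 0 ∨ ab.1.2 i₀ = 0) → E f ab = 0) :
      kohnLap n f = 0 := by
    ext d
    rw [coeff_zero]
    by_cases hw : Finsupp.weight (bidegWt n) (d + normExp i₀) = (p, q)
    · set e := d + normExp i₀ with he
      have hmem : ((fun i => e (Sum.inl i)), (fun i => e (Sum.inr i))) ∈ bidegPairs n p q := by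
        rw [mem_bidegPairs, bidegExp_eta, hw]
      have hne : ¬ (e (Sum.inl i₀) = 0 ∨ e (Sum.inr i₀) = 0) := by simp [he]
      have := hf ⟨_, hmem⟩ hne
      rwa [hE2 _ _ hne, bidegExp_eta, he, add_tsub_cancel_right] at this
    · rw [coeff_kohnLap]
      refine Finset.sum_eq_zero fun i _ => ?_
      rw [f.2.coeff_eq_zero, mul_zero]
      rwa [map_add, weight_normExp, ← weight_normExp i₀, ← map_add]
  have hinj : Function.Injective E := by
    rw [injective_iff_map_eq_zero]
    intro f h0
    rw [Subtype.ext_iff]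
    refine eq_zero_of_kohnLap_of_coeff i₀ f (hΔ f fun ab _ => congrFun h0 ab) fun d hd => ?_
    by_cases hw : Finsupp.weight (bidegWt n) d = (p, q)
    · have hmem : ((fun i => d (Sum.inl i)), (fun i => d (Sum.inr i))) ∈ bidegPairs n p q := by
        rw [mem_bidegPairs, bidegExp_eta, hw]
      have := hE1 f ⟨_, hmem⟩ hd
      rwa [h0, bidegExp_eta, Pi.zero_apply, eq_comm] at this
    · exact f.2.coeff_eq_zero d hw
  have hsurj : Function.Surjective E :=
    (LinearMap.injective_iff_surjective_of_finrank_eq_finrank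
      (coeffEquiv n p q).finrank_eq).mp hinj
  intro c
  obtain ⟨f, hf⟩ := hsurj fun ab => if h : ab.1 ∈ reducedPairs p q i₀ then c ⟨ab.1, h⟩ else 0
  refine ⟨⟨f, f.2, hΔ f fun ab h => ?_⟩, ?_⟩
  · rw [hf]
    exact dif_neg fun h' => h (mem_reducedPairs.mp h').2
  ext ab
  obtain ⟨h1, h2⟩ := mem_reducedPairs.mp ab.2
  have := hE1 f ⟨ab.1, h1⟩ h2
  rw [hf] at this
  exact this.symm.trans (dif_pos ab.2)

/-- Harmonic polynomials correspond to families of coefficients at the monomials not divisible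
by `zᵢ z̄ᵢ`. -/
def reducedCoeffEquiv (p q : ℕ) (i₀ : Fin n) : Hpq n p q ≃ₗ[ℂ] (reducedPairs p q i₀ → ℂ) :=
  LinearEquiv.ofBijective (reducedCoeff p q i₀)
    ⟨reducedCoeff_injective p q i₀, reducedCoeff_surjective p q i₀⟩

lemma trace_linSubstHpq_diagonal {x y : Fin n → ℂ} (hxy : diagonal x * (diagonal y)ᵀ = 1)
    (p q : ℕ) (i₀ : Fin n) :
    LinearMap.trace ℂ (Hpq n p q) (linSubstHpq hxy p q) =
      ∑ ab ∈ reducedPairs p q i₀, (∏ i, x i ^ ab.1 i) * ∏ i, y i ^ ab.2 i := by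
  rw [LinearMap.trace_eq_matrix_trace ℂ (Module.Basis.ofEquivFun (reducedCoeffEquiv p q i₀)),
    Matrix.trace, ← Finset.sum_coe_sort (reducedPairs p q i₀)]
  refine Finset.sum_congr rfl fun ab _ => ?_
  set b := Module.Basis.ofEquivFun (reducedCoeffEquiv p q i₀) with hb
  have hrepr (f : Hpq n p q) : b.repr f ab =
      coeff (bidegExp ab.1.1 ab.1.2) (f : MvPolynomial (Var n) ℂ) := rfl
  have hone : b.repr (b ab) ab = 1 := by simp
  rw [Matrix.diag_apply, LinearMap.toMatrix_apply, hrepr]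
  rw [hrepr] at hone
  change coeff _ (linSubst (diagonal x) (diagonal y) _) = _
  rw [coeff_linSubst_diagonal, Submodule.subtype_apply, hone, mul_one]
  rfl

end Basis

section Trace

variable {n : ℕ}

open Module in
/-- Over `ℂ`, a matrix of finite order is diagonalizable. -/
lemma exists_diagonalization_of_pow_eq_one {A : Matrix (Fin n) (Fin n) ℂ} {N : ℕ} (hN : N ≠ 0)
    (hA : A ^ N = 1) :
    ∃ (P Q : Matrix (Fin n) (Fin n) ℂ) (x : Fin n → ℂ), P * Q = 1 ∧ A = P * diagonal x * Q := by
  set f : End ℂ (Fin n → ℂ) := Matrix.toLin' A with hf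
  have hss : f.IsSemisimple := by
    refine Module.End.isSemisimple_of_squarefree_aeval_eq_zero
      (p := (Polynomial.X ^ N - 1 : Polynomial ℂ)) ?_ ?_
    · exact (Polynomial.separable_X_pow_sub_C (1 : ℂ) (Nat.cast_ne_zero.mpr hN)
        one_ne_zero).squarefree
    · have : f ^ N = 1 := by
        rw [hf, ← Matrix.toLin'_pow, hA, Matrix.toLin'_one]
        rfl
      simp [this]
  have hspan : ⊤ ≤ Submodule.span ℂ {v : Fin n → ℂ | ∃ μ : ℂ, f v = μ • v} := by
    rw [← hss.iSup_eigenspace_eq_top]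
    exact iSup_le fun μ v hv => Submodule.subset_span ⟨μ, Module.End.mem_eigenspace_iff.mp hv⟩
  let b₀ := Basis.ofSpan hspan
  have : Fintype _ := FiniteDimensional.fintypeBasisIndex b₀
  let b : Basis (Fin n) ℂ (Fin n → ℂ) := b₀.reindex (Fintype.equivOfCardEq (by
    rw [← Module.finrank_eq_card_basis b₀]; simp))
  have hb (i : Fin n) : ∃ μ : ℂ, f (b i) = μ • b i := by
    simp only [b, Basis.reindex_apply]
    exact Basis.ofSpan_subset hspan ⟨_, rfl⟩
  choose x hx using hb
  let e := Pi.basisFun ℂ (Fin n)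
  refine ⟨e.toMatrix b, b.toMatrix e, x, Basis.toMatrix_mul_toMatrix_flip e b, ?_⟩
  have hdiag : LinearMap.toMatrix b b f = diagonal x := by
    ext i j
    rw [LinearMap.toMatrix_apply, hx]
    by_cases h : i = j
    · simp [h]
    · simp [h]
  rw [← hdiag, basis_toMatrix_mul_linearMap_toMatrix_mul_basis_toMatrix]
  exact (LinearMap.toMatrix'_toLin' A).symm

lemma linSubstHpq_comp {A B A' B' A'' B'' : Matrix (Fin n) (Fin n) ℂ} (h : A * Bᵀ = 1)
    (h' : A' * B'ᵀ = 1) (h'' : A'' * B''ᵀ = 1) (hA : A' * A = A'') (hB : B' * B = B'') (p q : ℕ) :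
    linSubstHpq h p q ∘ₗ linSubstHpq h' p q = linSubstHpq h'' p q := by
  subst hA hB
  ext1 f
  exact Subtype.ext (DFunLike.congr_fun (linSubst_comp A B A' B') f.1)

lemma linSubstHpq_one (h : (1 : Matrix (Fin n) (Fin n) ℂ) * 1ᵀ = 1) (p q : ℕ) :
    linSubstHpq h p q = LinearMap.id := by
  ext1 f
  exact Subtype.ext (DFunLike.congr_fun linSubst_one f.1)

lemma trace_linSubstHpq_conj {A B P Q : Matrix (Fin n) (Fin n) ℂ} {x y : Fin n → ℂ}
    (h : A * Bᵀ = 1) (hPQ : P * Q = 1) (hxy : diagonal x * (diagonal y)ᵀ = 1)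
    (hA : A = P * diagonal x * Q) (p q : ℕ) :
    LinearMap.trace ℂ (Hpq n p q) (linSubstHpq h p q) =
      LinearMap.trace ℂ (Hpq n p q) (linSubstHpq hxy p q) := by
  have hQP : Q * P = 1 := mul_eq_one_comm.mp hPQ
  have hB : B = Qᵀ * diagonal y * Pᵀ := by
    have h1 : A * (P * diagonal y * Q) = 1 := by
      calc A * (P * diagonal y * Q)
          = P * (diagonal x * (Q * P) * diagonal y) * Q := by simp only [hA, Matrix.mul_assoc]
        _ = 1 := by
          rw [hQP, Matrix.mul_one]
          rw [diagonal_transpose] at hxy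
          rw [hxy, Matrix.mul_one, hPQ]
    have h2 : Bᵀ = P * diagonal y * Q := by
      rw [← Matrix.one_mul Bᵀ, ← mul_eq_one_comm.mp h1, Matrix.mul_assoc, h, Matrix.mul_one]
    rw [← Matrix.transpose_transpose B, h2]
    simp [Matrix.transpose_mul, Matrix.mul_assoc]
  have hP : P * (Qᵀ)ᵀ = 1 := by simpa using hPQ
  have hQ : Q * (Pᵀ)ᵀ = 1 := by simpa using hQP
  have hPD : (P * diagonal x) * (Qᵀ * diagonal y)ᵀ = 1 := by
    rw [Matrix.transpose_mul, Matrix.mul_assoc, ← Matrix.mul_assoc (diagonal x), hxy,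
      Matrix.one_mul, hP]
  rw [← linSubstHpq_comp hQ hPD h hA.symm hB.symm, LinearMap.trace_comp_comm',
    ← linSubstHpq_comp hxy hP hPD rfl rfl, LinearMap.comp_assoc,
    linSubstHpq_comp hP hQ (A'' := 1) (B'' := 1) (by simp) hQP
      (by rw [← Matrix.transpose_mul, hQP, Matrix.transpose_one]), linSubstHpq_one,
    LinearMap.comp_id]

/-- The action of the unitary group on `H_{p,q}`. -/
def unitaryRep (n p q : ℕ) : Representation ℂ (Matrix.unitaryGroup (Fin n) ℂ) (Hpq n p q) where
  toFun g := linSubstHpq (unitary_mul_transpose_map g⁻¹) p q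
  map_one' := by
    ext1 f
    exact Subtype.ext (DFunLike.congr_fun uAct_one f.1)
  map_mul' g h := by
    ext1 f
    exact Subtype.ext (DFunLike.congr_fun (uAct_mul g h) f.1)

/-- The character of `H_{p,q}` at a nontrivial unitary matrix of finite order. -/
lemma exists_trace_unitaryRep {g : Matrix.unitaryGroup (Fin n) ℂ} {N : ℕ} (hN : N ≠ 0)
    (hg : g ^ N = 1) (hg1 : g ≠ 1) :
    ∃ (x : Fin n → ℂ) (i₀ : Fin n), (∀ i, x i ^ N = 1) ∧ x i₀ ≠ 1 ∧
      ∀ p q, LinearMap.trace ℂ (Hpq n p q) (unitaryRep n p q g) =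
        ∑ ab ∈ reducedPairs p q i₀, (∏ i, x i ^ ab.1 i) * ∏ i, (x i)⁻¹ ^ ab.2 i := by
  set A : Matrix (Fin n) (Fin n) ℂ := ((g⁻¹ : Matrix.unitaryGroup (Fin n) ℂ) :) with hAdef
  have hA : A ^ N = 1 := by
    rw [hAdef, ← SubmonoidClass.coe_pow, inv_pow, hg, inv_one]
    rfl
  obtain ⟨P, Q, x, hPQ, hAx⟩ := exists_diagonalization_of_pow_eq_one hN hA
  have hQP : Q * P = 1 := mul_eq_one_comm.mp hPQ
  have hpow (k : ℕ) : Q * A ^ k * P = diagonal x ^ k := by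
    induction k with
    | zero => simp [hQP]
    | succ k ih =>
      rw [pow_succ, pow_succ, ← ih, hAx]
      simp only [Matrix.mul_assoc, hQP, Matrix.mul_one]
  have hx (i : Fin n) : x i ^ N = 1 := by
    have := hpow N
    rw [hA, Matrix.mul_one, hQP, Matrix.diagonal_pow] at this
    simpa using (congrFun (congrFun this i) i).symm
  have hx0 (i : Fin n) : x i ≠ 0 := by
    intro h
    have := hx i
    simp [h, hN] at this
  obtain ⟨i₀, hi₀⟩ : ∃ i, x i ≠ 1 := by
    by_contra! h
    apply hg1
    have : A = 1 := by
      rw [hAx, show x = 1 from funext h, diagonal_one', Matrix.mul_one, hPQ]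
    rw [← inv_eq_one]
    exact Subtype.ext this
  have hxy : diagonal x * (diagonal fun i => (x i)⁻¹)ᵀ = 1 := by
    rw [diagonal_transpose, diagonal_mul_diagonal, ← diagonal_one]
    congr 1
    ext i
    exact mul_inv_cancel₀ (hx0 i)
  refine ⟨x, i₀, hx, hi₀, fun p q => ?_⟩
  rw [← trace_linSubstHpq_diagonal hxy p q i₀]
  exact trace_linSubstHpq_conj (unitary_mul_transpose_map g⁻¹) hPQ hxy hAx p q

lemma trace_average_eq_dimHpqInv (G : Subgroup (Matrix.unitaryGroup (Fin n) ℂ)) [Fintype G]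
    (p q : ℕ) :
    (Nat.card G : ℂ)⁻¹ * ∑ g : G, LinearMap.trace ℂ (Hpq n p q) (unitaryRep n p q g) =
      dimHpqInv n p q (G : Set (Matrix.unitaryGroup (Fin n) ℂ)) := by
  let ρ : Representation ℂ G (Hpq n p q) := (unitaryRep n p q).comp G.subtype
  have hcard : (Nat.card G : ℂ) ≠ 0 := Nat.cast_ne_zero.mpr Nat.card_pos.ne'
  let _ : Invertible (Nat.card G : ℂ) := invertibleOfNonzero hcard
  have h := ρ.card_inv_mul_sum_char_eq_finrank
  have hinv : ρ.invariants.map (Hpq n p q).subtype =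
      HpqInv n p q (G : Set (Matrix.unitaryGroup (Fin n) ℂ)) := by
    ext f
    simp only [Submodule.mem_map, Representation.mem_invariants, HpqInv, Submodule.mem_inf,
      Submodule.mem_iInf, LinearMap.mem_ker, LinearMap.sub_apply, sub_eq_zero]
    constructor
    · rintro ⟨f, hf, rfl⟩
      exact ⟨f.2, fun g hg => congrArg Subtype.val (hf ⟨g, hg⟩)⟩
    · rintro ⟨hf, hG⟩
      exact ⟨⟨f, hf⟩, fun g => Subtype.ext (hG g.1 g.2), rfl⟩
  rw [dimHpqInv, ← hinv, Submodule.finrank_map_subtype_eq, ← h]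
  rfl

end Trace

section Estimates

/-- The complete homogeneous symmetric polynomial of degree `m` in the variables `xᵢ`, `i ∈ s`. -/
def completeSum {ι : Type*} [Fintype ι] [DecidableEq ι] (s : Finset ι) (x : ι → ℂ) (m : ℕ) : ℂ :=
  ∑ a ∈ Finset.piAntidiag s m, ∏ i, x i ^ a i

variable {ι : Type*} [Fintype ι] [DecidableEq ι]

lemma completeSum_cons {s : Finset ι} {i : ι} (hi : i ∉ s) (x : ι → ℂ) (m : ℕ) :
    completeSum (Finset.cons i s hi) x m =
      ∑ k ∈ Finset.HasAntidiagonal.antidiagonal m, completeSum s x k.1 * x i ^ k.2 := by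
  rw [completeSum, Finset.piAntidiag_cons, Finset.sum_disjiUnion,
    ← Finset.Nat.sum_antidiagonal_swap]
  refine Finset.sum_congr rfl fun k _ => ?_
  rw [completeSum, Finset.sum_map, Finset.sum_mul]
  refine Finset.sum_congr rfl fun a _ => ?_
  rw [← Fintype.prod_ite_eq' i fun j => x j ^ k.2, ← Finset.prod_mul_distrib]
  refine Finset.prod_congr rfl fun j _ => ?_
  by_cases hj : j = i <;> simp [hj, pow_add]

lemma completeSum_cons_succ_sub {s : Finset ι} {i : ι} (hi : i ∉ s) (x : ι → ℂ) (m : ℕ) :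
    completeSum (Finset.cons i s hi) x (m + 1) - completeSum s x (m + 1) =
      x i * completeSum (Finset.cons i s hi) x m := by
  rw [completeSum_cons, completeSum_cons, Finset.Nat.sum_antidiagonal_succ', Finset.mul_sum]
  simp only [pow_zero, mul_one, add_sub_cancel_left, pow_succ]
  exact Finset.sum_congr rfl fun k _ => by ring

lemma Nat.sum_range_succ_multichoose (k m : ℕ) :
    ∑ j ∈ Finset.range (m + 1), k.multichoose j = (k + 1).multichoose m := by
  rw [Nat.sum_range_multichoose, Nat.multichoose_eq, show k + 1 + m - 1 = m + k by omega,
    Nat.choose_symm_add]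

lemma norm_completeSum_le (s : Finset ι) {x : ι → ℂ} (hx : ∀ i, ‖x i‖ = 1) (m : ℕ) :
    ‖completeSum s x m‖ ≤ (s.card.multichoose m : ℝ) := by
  induction s using Finset.cons_induction generalizing m with
  | empty =>
    rcases m with _ | m
    · simp [completeSum]
    · simp [completeSum]
  | cons i s hi ih =>
    rw [completeSum_cons, Finset.card_cons, Finset.Nat.sum_antidiagonal_eq_sum_range_succ_mk,
      ← Nat.sum_range_succ_multichoose, Nat.cast_sum]
    refine norm_sum_le_of_le _ fun k _ => ?_
    rw [norm_mul, norm_pow, hx, one_pow, mul_one]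
    exact ih k

lemma norm_geom_sum_le_of_pow_eq_one {z : ℂ} {N : ℕ} (hN : N ≠ 0) (hz : z ^ N = 1) (hz1 : z ≠ 1)
    (M : ℕ) : ‖∑ k ∈ Finset.range M, z ^ k‖ ≤ N := by
  induction M using Nat.strong_induction_on with
  | _ M ih =>
    by_cases hM : M ≤ N
    · refine (norm_sum_le _ _).trans ?_
      have hz' : ‖z‖ = 1 := norm_eq_one_of_pow_eq_one hz hN
      simpa [hz'] using hM
    · obtain ⟨K, rfl⟩ := Nat.exists_eq_add_of_le (not_le.mp hM).le
      rw [Finset.sum_range_add, geom_sum_eq hz1, hz, sub_self, zero_div, zero_add]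
      simp only [pow_add, hz, one_mul]
      exact ih K (by omega)

lemma norm_sum_completeSum_cons_le {s : Finset ι} {i : ι} (hi : i ∉ s) {x : ι → ℂ} {N : ℕ}
    (hN : N ≠ 0) (hx : ∀ j, x j ^ N = 1) (hxi : x i ≠ 1) (M : ℕ) :
    ‖∑ m ∈ Finset.range M, completeSum (Finset.cons i s hi) x m‖ ≤
      N * ∑ m ∈ Finset.range M, (s.card.multichoose m : ℝ) := by
  simp only [completeSum_cons, Finset.Nat.sum_antidiagonal_eq_sum_range_succ_mk]
  rw [Finset.sum_range_diag_flip M fun m k => completeSum s x m * x i ^ k, Finset.mul_sum]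
  refine norm_sum_le_of_le _ fun m _ => ?_
  rw [← Finset.mul_sum, norm_mul, mul_comm]
  exact mul_le_mul (norm_geom_sum_le_of_pow_eq_one hN (hx i) hxi _)
    (norm_completeSum_le s (fun j => norm_eq_one_of_pow_eq_one (hx j) hN) m)
    (norm_nonneg _) (Nat.cast_nonneg _)

lemma multichoose_pred {n : ℕ} (hn : 2 ≤ n) (m : ℕ) :
    (n - 1).multichoose m = (m + n - 2).choose (n - 2) := by
  rw [Nat.multichoose_eq, show n - 1 + m - 1 = m + (n - 2) by omega,
    show m + n - 2 = m + (n - 2) by omega, Nat.choose_symm_add]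

lemma sum_range_multichoose_pred {n : ℕ} (hn : 2 ≤ n) (M : ℕ) :
    ∑ m ∈ Finset.range M, (n - 1).multichoose m = (M + n - 2).choose (n - 1) := by
  rcases M with _ | M
  · rw [Finset.sum_range_zero, Nat.choose_eq_zero_of_lt (by omega)]
  · rw [Nat.sum_range_multichoose, show M + 1 + n - 2 = M + (n - 1) by omega]

lemma sum_reducedPairs {n : ℕ} (x y : Fin n → ℂ) (p q : ℕ) (i₀ : Fin n) :
    ∑ ab ∈ reducedPairs p q i₀, (∏ i, x i ^ ab.1 i) * ∏ i, y i ^ ab.2 i =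
      completeSum Finset.univ x p * completeSum (Finset.univ.erase i₀) y q +
        completeSum (Finset.univ.erase i₀) x p *
          (completeSum Finset.univ y q - completeSum (Finset.univ.erase i₀) y q) := by
  have herase (x : Fin n → ℂ) (m : ℕ) : completeSum (Finset.univ.erase i₀) x m =
      ∑ a ∈ Finset.piAntidiag Finset.univ m, if a i₀ = 0 then ∏ i, x i ^ a i else 0 := by
    rw [← Finset.sum_filter, completeSum]
    refine Finset.sum_congr ?_ fun _ _ => rfl
    ext a
    simp only [Finset.mem_piAntidiag, Finset.mem_filter, Finset.mem_erase, Finset.mem_univ,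
      and_true, implies_true]
    have hsum := Finset.add_sum_erase Finset.univ a (Finset.mem_univ i₀)
    constructor
    · rintro ⟨h1, h2⟩
      have h0 : a i₀ = 0 := by
        by_contra h
        exact h2 i₀ h rfl
      refine ⟨?_, h0⟩
      rw [← hsum, h0, zero_add]
      exact h1
    · rintro ⟨h1, h0⟩
      rw [h0, zero_add] at hsum
      refine ⟨hsum.trans h1, ?_⟩
      rintro i hi rfl
      exact hi h0
  rw [herase, herase, reducedPairs, bidegPairs, Finset.sum_filter, Finset.sum_product,
    completeSum, completeSum, ← Finset.sum_sub_distrib, Finset.sum_mul_sum, Finset.sum_mul_sum,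
    ← Finset.sum_add_distrib]
  refine Finset.sum_congr rfl fun a _ => ?_
  rw [← Finset.sum_add_distrib]
  refine Finset.sum_congr rfl fun b _ => ?_
  by_cases ha : a i₀ = 0 <;> by_cases hb : b i₀ = 0 <;> simp [ha, hb]

end Estimates

section Counting

variable {n : ℕ}

/-- The pairs `(p, q)` with `0 < q(p+n-1) ≤ λ`. -/
def bidegRegion (n : ℕ) (lam : ℝ) : Finset (ℕ × ℕ) :=
  (Finset.range (⌊lam⌋₊ + 1) ×ˢ Finset.range (⌊lam⌋₊ + 1)).filter
    (fun pq => 0 < pq.2 * (pq.1 + n - 1) ∧ ((pq.2 * (pq.1 + n - 1) : ℕ) : ℝ) ≤ lam)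

lemma mem_bidegRegion (hn : 2 ≤ n) {lam : ℝ} (hlam : 0 < lam) {p q : ℕ} :
    (p, q) ∈ bidegRegion n lam ↔ 1 ≤ q ∧ q * (p + n - 1) ≤ ⌊lam⌋₊ := by
  simp only [bidegRegion, Finset.mem_filter, Finset.mem_product, Finset.mem_range,
    ← Nat.le_floor_iff hlam.le]
  constructor
  · rintro ⟨-, h1, h2⟩
    exact ⟨Nat.pos_of_mul_pos_right h1, h2⟩
  · rintro ⟨h1, h2⟩
    have hp : p + n - 1 ≤ q * (p + n - 1) := Nat.le_mul_of_pos_left _ h1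
    have hq : q ≤ q * (p + n - 1) := Nat.le_mul_of_pos_right _ (by omega)
    exact ⟨⟨by omega, by omega⟩, Nat.mul_pos h1 (by omega), h2⟩

lemma mem_bidegRegion_iff_left (hn : 2 ≤ n) {lam : ℝ} (hlam : 0 < lam) (pq : ℕ × ℕ) :
    pq ∈ bidegRegion n lam ↔ pq.1 ∈ Finset.range (⌊lam⌋₊ + 2 - n) ∧
      pq.2 ∈ Finset.Icc 1 (⌊lam⌋₊ / (pq.1 + n - 1)) := by
  obtain ⟨p, q⟩ := pq
  rw [mem_bidegRegion hn hlam, Finset.mem_range, Finset.mem_Icc,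
    Nat.le_div_iff_mul_le (show 0 < p + n - 1 by omega)]
  constructor
  · rintro ⟨h1, h2⟩
    have hp : p + n - 1 ≤ q * (p + n - 1) := Nat.le_mul_of_pos_left _ h1
    exact ⟨by omega, h1, h2⟩
  · exact fun h => h.2

lemma mem_bidegRegion_iff_right (hn : 2 ≤ n) {lam : ℝ} (hlam : 0 < lam) (pq : ℕ × ℕ) :
    pq ∈ bidegRegion n lam ↔ pq.2 ∈ Finset.Icc 1 (⌊lam⌋₊ / (n - 1)) ∧
      pq.1 ∈ Finset.range (⌊lam⌋₊ / pq.2 + 2 - n) := by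
  obtain ⟨p, q⟩ := pq
  rw [mem_bidegRegion hn hlam, Finset.mem_range, Finset.mem_Icc,
    Nat.le_div_iff_mul_le (show 0 < n - 1 by omega)]
  have key (hq : 1 ≤ q) : q * (p + n - 1) ≤ ⌊lam⌋₊ ↔ p < ⌊lam⌋₊ / q + 2 - n := by
    rw [mul_comm, ← Nat.le_div_iff_mul_le hq]
    omega
  constructor
  · rintro ⟨h1, h2⟩
    exact ⟨⟨h1, (Nat.mul_le_mul_left q (by omega)).trans h2⟩, (key h1).mp h2⟩
  · rintro ⟨⟨h1, -⟩, h2⟩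
    exact ⟨h1, (key h1).mpr h2⟩

lemma Xi_eq (hn : 2 ≤ n) (lam : ℝ) :
    Xi n lam = (∑ k ∈ Finset.range (⌊lam⌋₊ + 2 - n),
      (n - 1).multichoose k *
        ∑ m ∈ Finset.range (⌊lam⌋₊ / (k + n - 1)), (n - 1).multichoose m) +
      ∑ k ∈ Finset.Icc 1 (⌊lam⌋₊ / (n - 1)),
        (n - 1).multichoose k * Nat.choose (⌊lam⌋₊ / k) (n - 1) := by
  have h1 (k : ℕ) : ⌊lam / ((k : ℝ) + n - 1)⌋₊ = ⌊lam⌋₊ / (k + n - 1) := by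
    rw [← Nat.floor_div_natCast, Nat.cast_sub (by omega)]
    push_cast
    rfl
  have h2 : ⌊lam / ((n : ℝ) - 1)⌋₊ = ⌊lam⌋₊ / (n - 1) := by
    rw [← Nat.floor_div_natCast, Nat.cast_sub (by omega)]
    push_cast
    rfl
  simp only [Xi, h1, h2, Nat.floor_div_natCast, sum_range_multichoose_pred hn]
  simp only [multichoose_pred hn]

lemma norm_sum_reducedPairs_le (hn : 2 ≤ n) {lam : ℝ} (hlam : 0 < lam) {x : Fin n → ℂ} {N : ℕ}
    (hN : N ≠ 0) (hx : ∀ i, x i ^ N = 1) {i₀ : Fin n} (hi₀ : x i₀ ≠ 1) :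
    ‖∑ pq ∈ bidegRegion n lam, ∑ ab ∈ reducedPairs pq.1 pq.2 i₀,
      (∏ i, x i ^ ab.1 i) * ∏ i, (x i)⁻¹ ^ ab.2 i‖ ≤ N * Xi n lam := by
  set y : Fin n → ℂ := fun i => (x i)⁻¹
  have hy (i) : y i ^ N = 1 := by simp [y, inv_pow, hx]
  have hyi : y i₀ ≠ 1 := by simpa [y] using hi₀
  have hx1 (i) : ‖x i‖ = 1 := norm_eq_one_of_pow_eq_one (hx i) hN
  have hy1 (i) : ‖y i‖ = 1 := norm_eq_one_of_pow_eq_one (hy i) hN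
  set s : Finset (Fin n) := Finset.univ.erase i₀ with hs
  have hi : i₀ ∉ s := Finset.notMem_erase _ _
  have hcons : Finset.univ = Finset.cons i₀ s hi := by simp [hs]
  have hcard : s.card = n - 1 := by simp [hs]
  have hsplit : ∑ pq ∈ bidegRegion n lam, ∑ ab ∈ reducedPairs pq.1 pq.2 i₀,
      (∏ i, x i ^ ab.1 i) * ∏ i, y i ^ ab.2 i =
      (∑ p ∈ Finset.range (⌊lam⌋₊ + 2 - n), completeSum s x p *
        (y i₀ * ∑ q ∈ Finset.range (⌊lam⌋₊ / (p + n - 1)),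
          completeSum (Finset.cons i₀ s hi) y q)) +
      ∑ q ∈ Finset.Icc 1 (⌊lam⌋₊ / (n - 1)), completeSum s y q *
        ∑ p ∈ Finset.range (⌊lam⌋₊ / q + 2 - n), completeSum (Finset.cons i₀ s hi) x p := by
    simp only [sum_reducedPairs, Finset.sum_add_distrib]
    rw [add_comm]
    congr 1
    · rw [Finset.sum_finset_product _ _ (fun p => Finset.Icc 1 (⌊lam⌋₊ / (p + n - 1)))
        (mem_bidegRegion_iff_left hn hlam)]
      refine Finset.sum_congr rfl fun p _ => ?_
      dsimp only
      rw [← Finset.mul_sum]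
      congr 1
      rw [← Finset.Ico_add_one_right_eq_Icc, Finset.sum_Ico_eq_sum_range, Finset.mul_sum]
      refine Finset.sum_congr rfl fun q _ => ?_
      rw [add_comm 1 q, ← hs, hcons]
      exact completeSum_cons_succ_sub hi y q
    · rw [Finset.sum_finset_product_right _ _ (fun q => Finset.range (⌊lam⌋₊ / q + 2 - n))
        (mem_bidegRegion_iff_right hn hlam)]
      refine Finset.sum_congr rfl fun q _ => ?_
      dsimp only
      rw [← Finset.sum_mul, mul_comm, ← hs, hcons]
  rw [hsplit, Xi_eq hn, Nat.cast_add, mul_add, Nat.cast_sum, Nat.cast_sum, Finset.mul_sum,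
    Finset.mul_sum]
  refine (norm_add_le _ _).trans (add_le_add ?_ ?_)
  · refine norm_sum_le_of_le _ fun p _ => ?_
    rw [norm_mul, norm_mul, hy1, one_mul, Nat.cast_mul, mul_left_comm, ← hcard, Nat.cast_sum]
    exact mul_le_mul (norm_completeSum_le s hx1 p) (norm_sum_completeSum_cons_le hi hN hy hyi _)
      (norm_nonneg _) (Nat.cast_nonneg _)
  · refine norm_sum_le_of_le _ fun q _ => ?_
    rw [norm_mul, Nat.cast_mul, mul_left_comm]
    refine mul_le_mul (hcard ▸ norm_completeSum_le s hy1 q) ?_ (norm_nonneg _) (Nat.cast_nonneg _)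
    refine (norm_sum_completeSum_cons_le hi hN hx hi₀ _).trans ?_
    rw [hcard, ← Nat.cast_sum, sum_range_multichoose_pred hn]
    by_cases hq : n - 2 ≤ ⌊lam⌋₊ / q
    · rw [show ⌊lam⌋₊ / q + 2 - n + n - 2 = ⌊lam⌋₊ / q by omega]
    · rw [show ⌊lam⌋₊ / q + 2 - n + n - 2 = n - 2 by omega,
        Nat.choose_eq_zero_of_lt (show n - 2 < n - 1 by omega), Nat.cast_zero, mul_zero]
      positivity

end Counting

theorem dimHG_sub_dimH_div_card_le (n : ℕ) (hn : 2 ≤ n)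
    (G : Subgroup (Matrix.unitaryGroup (Fin n) ℂ)) (hGfin : Finite G)
    (lam : ℝ) (hlam : 0 < lam) :
    |(dimHGlam n (G : Set _) lam : ℝ) - (dimHlam n lam : ℝ) / (Nat.card G)| ≤
      ((Nat.card G : ℝ) - 1) * Xi n lam := by
  classical
  have := Fintype.ofFinite G
  set N := Nat.card G with hNdef
  have hN : N ≠ 0 := Nat.card_pos.ne'
  let T (g : G) : ℂ :=
    ∑ pq ∈ bidegRegion n lam, LinearMap.trace ℂ (Hpq n pq.1 pq.2) (unitaryRep n pq.1 pq.2 g)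
  have hT1 : T 1 = dimHlam n lam := by
    rw [dimHlam, Nat.cast_sum]
    refine Finset.sum_congr rfl fun pq _ => ?_
    rw [OneMemClass.coe_one, map_one, LinearMap.trace_one]
  have hTG : (N : ℂ)⁻¹ * ∑ g, T g = dimHGlam n (G : Set _) lam := by
    rw [dimHGlam, Nat.cast_sum, Finset.sum_comm, Finset.mul_sum]
    exact Finset.sum_congr rfl fun pq _ => trace_average_eq_dimHpqInv G pq.1 pq.2
  have hT (g : G) (hg : g ≠ 1) : ‖T g‖ ≤ N * Xi n lam := by
    obtain ⟨x, i₀, hx, hi₀, htr⟩ := exists_trace_unitaryRep (g := g.1) hN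
      (by rw [← SubmonoidClass.coe_pow, pow_card_eq_one', OneMemClass.coe_one])
      (fun h => hg (Subtype.ext h))
    simp only [T, htr]
    exact norm_sum_reducedPairs_le hn hlam hN hx hi₀
  have hdiff : (((dimHGlam n (G : Set _) lam : ℝ) - (dimHlam n lam : ℝ) / N : ℝ) : ℂ) =
      (N : ℂ)⁻¹ * ∑ g ∈ Finset.univ.erase 1, T g := by
    push_cast
    rw [← hTG, ← hT1, ← Finset.add_sum_erase _ T (Finset.mem_univ 1)]
    ring
  rw [← Real.norm_eq_abs, ← Complex.norm_real, hdiff, norm_mul, norm_inv, Complex.norm_natCast]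
  have hN' : (0 : ℝ) < N := Nat.cast_pos.mpr (Nat.pos_of_ne_zero hN)
  rw [inv_mul_le_iff₀ hN']
  calc ‖∑ g ∈ Finset.univ.erase 1, T g‖
      ≤ ∑ g ∈ Finset.univ.erase (1 : G), (N : ℝ) * Xi n lam :=
        norm_sum_le_of_le _ fun g hg => hT g (Finset.ne_of_mem_erase hg)
    _ = N * ((N - 1) * Xi n lam) := by
      rw [Finset.sum_const, Finset.card_erase_of_mem (Finset.mem_univ _), Finset.card_univ,
        ← Nat.card_eq_fintype_card, nsmul_eq_mul, Nat.cast_sub (Nat.pos_of_ne_zero hN)]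
      push_cast
      ring
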